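/- (Duality of subsumption.) Let T be a TBox and C, D concepts of generalized ALC, and let T^d = { F^d ⊑ E^d | (E ⊑ F) ∈ T }, where ·^d denotes the dual concept. Then (T, C, D) ∈ SUBS if and only if (T^d, D^d, C^d) ∈ SUBS. (Note that if T, C, D use only operators ∘_f with f ∈ B and quantifiers from Q ⊆ {∃,∀}, then T^d, C^d, D^d use only operators ∘_g with g ∈ dual B and quantifiers from dual Q.) -/

import Mathlib

/-- Generalized ALC concepts over atomic concepts `At` and roles `Rol`. -/
inductive GConcept (At : Type) (Rol : Type) : Type
  | atom : At → GConcept At Rol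
  | op : (n : ℕ) → ((Fin n → Bool) → Bool) → (Fin n → GConcept At Rol) → GConcept At Rol
  | ex : Rol → GConcept At Rol → GConcept At Rol
  | all : Rol → GConcept At Rol → GConcept At Rol

/-- An interpretation: nonempty domain, sets for atomic concepts, relations for roles. -/
structure Interp (At : Type) (Rol : Type) where
  Δ : Type
  nonempty : Nonempty Δ
  atomI : At → Set Δ
  roleI : Rol → Set (Δ × Δ)

attribute [local instance] Classical.propDecidable

/-- The extension of a generalized concept in an interpretation. -/
noncomputable def gext {At Rol : Type} (I : Interp At Rol) : GConcept At Rol → Set I.Δ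
  | .atom A => I.atomI A
  | .op _ f Cs => {x | f (fun i => decide (x ∈ gext I (Cs i))) = true}
  | .ex R C => {x | ∃ y, (x, y) ∈ I.roleI R ∧ y ∈ gext I C}
  | .all R C => {x | ∀ y, (x, y) ∈ I.roleI R → y ∈ gext I C}

/-- `I` satisfies every axiom of the TBox `T`. -/
def gsatT {At Rol : Type} (I : Interp At Rol) (T : Set (GConcept At Rol × GConcept At Rol)) : Prop :=
  ∀ ax ∈ T, gext I ax.1 ⊆ gext I ax.2

/-- The subsumption problem. -/
def GSUBS {At Rol : Type} (T : Set (GConcept At Rol × GConcept At Rol))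
    (C D : GConcept At Rol) : Prop :=
  ∀ I : Interp At Rol, gsatT I T → gext I C ⊆ gext I D

/-- The dual concept: dualize every Boolean operator, swap the quantifiers. -/
def GConcept.dual {At Rol : Type} : GConcept At Rol → GConcept At Rol
  | .atom A => .atom A
  | .op n f Cs => .op n (fun b => ! f (fun i => ! b i)) (fun i => (Cs i).dual)
  | .ex R C => .all R C.dual
  | .all R C => .ex R C.dual

/-- The interpretation with the same domain and roles and complemented atomic concepts. -/
def Interp.compl {At Rol : Type} (I : Interp At Rol) : Interp At Rol where
  Δ := I.Δ
  nonempty := I.nonempty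
  atomI A := (I.atomI A)ᶜ
  roleI := I.roleI

theorem Interp.compl_compl {At Rol : Type} (I : Interp At Rol) : I.compl.compl = I :=
  congrArg (fun a => (⟨I.Δ, I.nonempty, a, I.roleI⟩ : Interp At Rol))
    (_root_.compl_compl I.atomI)

theorem mem_gext_compl_dual {At Rol : Type} (I : Interp At Rol) (C : GConcept At Rol) (x : I.Δ) :
    x ∈ gext I.compl C.dual ↔ x ∉ gext I C := by
  induction C generalizing x with
  | atom A => exact Iff.rfl
  | op n f Cs ih =>
    have h : (fun i => !decide (x ∈ gext I.compl (Cs i).dual)) =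
        fun i => decide (x ∈ gext I (Cs i)) := by
      funext i
      simp [ih i x]
    change (!f (fun i => !decide (x ∈ gext I.compl (Cs i).dual))) = true ↔
      ¬ f (fun i => decide (x ∈ gext I (Cs i))) = true
    rw [h]
    simp
  | ex R C ih =>
    change (∀ y, (x, y) ∈ I.roleI R → y ∈ gext I.compl C.dual) ↔
      ¬ ∃ y, (x, y) ∈ I.roleI R ∧ y ∈ gext I C
    simp only [ih, not_exists, not_and]
  | all R C ih =>
    change (∃ y, (x, y) ∈ I.roleI R ∧ y ∈ gext I.compl C.dual) ↔
      ¬ ∀ y, (x, y) ∈ I.roleI R → y ∈ gext I C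
    simp only [ih, not_forall, exists_prop]

theorem gext_compl_dual_subset_iff {At Rol : Type} (I : Interp At Rol) (C D : GConcept At Rol) :
    gext I.compl D.dual ⊆ gext I.compl C.dual ↔ gext I C ⊆ gext I D := by
  have h (E : GConcept At Rol) : gext I.compl E.dual = (gext I E)ᶜ :=
    Set.ext (mem_gext_compl_dual I E)
  rw [h, h]
  exact Set.compl_subset_compl

theorem gsatT_compl_dual_iff {At Rol : Type} (I : Interp At Rol)
    (T : Set (GConcept At Rol × GConcept At Rol)) :
    gsatT I.compl ((fun ax => (ax.2.dual, ax.1.dual)) '' T) ↔ gsatT I T := by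
  simp only [gsatT, Set.forall_mem_image, gext_compl_dual_subset_iff]

/-- duality of subsumption:
`(T, C, D) ∈ SUBS` iff `(T^d, D^d, C^d) ∈ SUBS`, where
`T^d = { F^d ⊑ E^d | (E ⊑ F) ∈ T }`. -/
theorem subs_duality {At Rol : Type} (T : Set (GConcept At Rol × GConcept At Rol))
    (C D : GConcept At Rol) :
    GSUBS T C D ↔ GSUBS ((fun ax => (ax.2.dual, ax.1.dual)) '' T) D.dual C.dual := by
  have compl_surjective : Function.Surjective (Interp.compl (At := At) (Rol := Rol)) :=
    fun I => ⟨I.compl, I.compl_compl⟩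
  unfold GSUBS
  conv_rhs => rw [compl_surjective.forall]
  simp only [gsatT_compl_dual_iff, gext_compl_dual_subset_iff]
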